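/- Finite-time blow up for the non-sign-definite model: Assume β₂ ≤ 1 ≤ β₁ < 2β₂. There exist nonnegative, infinitely differentiable initial data ω₀, ρ₀ compactly supported in (0,1) and a finite time T* ∈ (0,∞) such that no classical solution of the model (with associated flow map) with initial data (ω₀, ρ₀) exists on the whole time interval [0,T*]; equivalently, every classical solution with this data defined on [0,T) with T ≥ T* satisfies ∫₀^{T*} ‖ω(·,t)‖_∞ dt = ∞, ∫₀^{T*} ‖∂_x ρ(·,t)‖_∞ dt = ∞, and ∫₀^{T*} ‖∂_x u(·,t)‖_∞ dt = ∞. -/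

import Mathlib

open MeasureTheory

/-- The Biot–Savart velocity of the model:
`u(x,t) = x·∫_{min(β₂x,1)}^{min(β₁x,1)} ω(y,t)/y dy − x·∫_{min(β₁x,1)}^{1} ω(y,t)/y dy`. -/
noncomputable def vel (β₁ β₂ : ℝ) (ω : ℝ → ℝ → ℝ) (x t : ℝ) : ℝ :=
  x * (∫ y in (min (β₂ * x) 1)..(min (β₁ * x) 1), ω y t / y)
    - x * ∫ y in (min (β₁ * x) 1)..(1:ℝ), ω y t / y

/-- A classical solution of the model on `(0,1) × [0,T)`, together with its flow map `Φ`. -/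
structure IsClassicalSolution (β₁ β₂ T : ℝ) (ω ρ Φ : ℝ → ℝ → ℝ) : Prop where
  Tpos : 0 < T
  omega_smooth : ContDiffOn ℝ 1 (fun p : ℝ × ℝ => ω p.1 p.2) (Set.Ioo 0 1 ×ˢ Set.Ico 0 T)
  rho_smooth : ContDiffOn ℝ 1 (fun p : ℝ × ℝ => ρ p.1 p.2) (Set.Ioo 0 1 ×ˢ Set.Ico 0 T)
  omega_nonneg : ∀ x t, 0 ≤ ω x t
  rho_nonneg : ∀ x t, 0 ≤ ρ x t
  supp : ∀ t, 0 ≤ t → t < T → ∃ a b : ℝ, 0 < a ∧ a ≤ b ∧ b < 1 ∧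
      ∀ x, x ∉ Set.Icc a b → ω x t = 0 ∧ ρ x t = 0
  omega_eq : ∀ x ∈ Set.Ioo (0:ℝ) 1, ∀ t, 0 ≤ t → t < T →
      derivWithin (fun s => ω x s) (Set.Ico 0 T) t
        + vel β₁ β₂ ω x t * deriv (fun y => ω y t) x = ρ x t / x
  rho_eq : ∀ x ∈ Set.Ioo (0:ℝ) 1, ∀ t, 0 ≤ t → t < T →
      derivWithin (fun s => ρ x s) (Set.Ico 0 T) t
        + vel β₁ β₂ ω x t * deriv (fun y => ρ y t) x = 0
  flow_init : ∀ x ∈ Set.Ioo (0:ℝ) 1, Φ x 0 = x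
  flow_deriv : ∀ x ∈ Set.Ioo (0:ℝ) 1, ∀ t, 0 ≤ t → t < T →
      HasDerivWithinAt (fun s => Φ x s) (vel β₁ β₂ ω (Φ x t) t) (Set.Ico 0 T) t
  flow_mono : ∀ t, 0 ≤ t → t < T → StrictMonoOn (fun x => Φ x t) (Set.Ioo 0 1)
  flow_bij : ∀ t, 0 ≤ t → t < T → Set.BijOn (fun x => Φ x t) (Set.Ioo 0 1) (Set.Ioo 0 1)

/-- Up to an error `M`, `y ↦ y * w y` is nondecreasing on `(0, X]`, while `w` is pinched between
`1` and `2 * κ` to the right of `X` (the lower bound holding only up to `Y`). -/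
structure AlmostOrdered (κ M X Y : ℝ) (w : ℝ → ℝ) : Prop where
  order : ∀ x y, 0 < x → x ≤ y → y ≤ X → x * w x ≤ y * (w y + M)
  outer_le : ∀ y, X ≤ y → w y ≤ 2 * κ
  outer_ge : ∀ y, X ≤ y → y ≤ Y → 1 ≤ w y

section FixedTime

theorem AlmostOrdered.neg_two_mul_le {κ M X Y z : ℝ} {w : ℝ → ℝ} (h : AlmostOrdered κ M X Y w)
    (hw : ∀ y, 0 ≤ w y) (hκ : 1 / 2 < κ) (hκ1 : κ ≤ 1) (hM : 0 ≤ M) (hX : 0 < X) (hzY : z ≤ Y)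
    {y : ℝ} (hy : 0 < y) (hyz : y ≤ z) : -(2 * M) ≤ 2 * w y - w (κ * y) := by
  have hκy : 0 < κ * y := by positivity
  have hκyy : κ * y ≤ y := by nlinarith
  rcases le_or_gt y X with hyX | hyX
  · have h1 := h.order (κ * y) y hκy hκyy hyX
    have h2 : κ * w (κ * y) ≤ w y + M := by
      refine le_of_mul_le_mul_left ?_ hy
      linarith
    nlinarith [hw (κ * y)]
  · have hge := h.outer_ge y hyX.le (hyz.trans hzY)
    rcases le_or_gt (κ * y) X with hk | hk
    · have h1 := h.order (κ * y) X hκy hk le_rfl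
      have h2 := h.outer_le X le_rfl
      have h3 : κ * w (κ * y) ≤ 2 * κ + M := by
        refine le_of_mul_le_mul_left ?_ hy
        nlinarith [hw X]
      have h4 : κ * w (κ * y) ≤ κ * (2 + 2 * M) := by nlinarith
      have h5 := le_of_mul_le_mul_left h4 (by linarith)
      linarith
    · have := h.outer_le (κ * y) hk.le
      linarith

variable {β₁ β₂ κ : ℝ} {ω : ℝ → ℝ → ℝ} {t : ℝ}

theorem vel_div_sub_vel_div (hβ : β₂ = κ * β₁) (hκ0 : 0 < κ) (hκ1 : κ ≤ 1) (hβ₁ : 1 ≤ β₁)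
    (hc : Continuous fun y => ω y t / y) {x₁ x₂ : ℝ} (h1 : 0 < x₁) (h12 : x₁ ≤ x₂)
    (h2 : β₁ * x₂ ≤ 1) :
    vel β₁ β₂ ω x₂ t / x₂ - vel β₁ β₂ ω x₁ t / x₁
      = ∫ y in (β₁ * x₁)..(β₁ * x₂), (2 * ω y t - ω (κ * y) t) / y := by
  have hi : ∀ a b : ℝ, IntervalIntegrable (fun y => ω y t / y) volume a b :=
    fun a b => hc.intervalIntegrable a b
  have key : ∀ x, 0 < x → β₁ * x ≤ 1 → vel β₁ β₂ ω x t / x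
      = (∫ y in (0:ℝ)..(β₁ * x), ω y t / y) * 2 - (∫ y in (0:ℝ)..(κ * (β₁ * x)), ω y t / y)
        - ∫ y in (0:ℝ)..1, ω y t / y := by
    intro x hx hx1
    have hβ₂x : β₂ * x = κ * (β₁ * x) := by rw [hβ]; ring
    have : κ * (β₁ * x) ≤ 1 := by nlinarith [mul_pos (by linarith : 0 < β₁) hx]
    rw [vel, min_eq_left hx1, hβ₂x, min_eq_left this,
      ← intervalIntegral.integral_interval_sub_left (hi 0 (β₁ * x)) (hi 0 (κ * (β₁ * x))),
      ← intervalIntegral.integral_interval_sub_left (hi 0 1) (hi 0 (β₁ * x))]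
    field_simp
    ring
  have hx2 : 0 < x₂ := h1.trans_le h12
  have hs : ∫ y in (β₁ * x₁)..(β₁ * x₂), ω (κ * y) t / y
      = ∫ y in (κ * (β₁ * x₁))..(κ * (β₁ * x₂)), ω y t / y := by
    rw [← intervalIntegral.mul_integral_comp_mul_left (c := κ) (a := β₁ * x₁) (b := β₁ * x₂),
      ← intervalIntegral.integral_const_mul]
    congr 1
    ext y
    field_simp
  have hc' : Continuous fun y => ω (κ * y) t / y := by
    have := (hc.comp (continuous_const_mul κ)).const_mul κ
    refine this.congr fun y => ?_
    simp only [Function.comp]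
    field_simp
  have : (fun y => (2 * ω y t - ω (κ * y) t) / y)
      = fun y => 2 * (ω y t / y) - ω (κ * y) t / y := by
    ext y; ring
  rw [key x₂ hx2 h2, key x₁ h1 (by nlinarith), this,
    intervalIntegral.integral_sub ((hi _ _).const_mul 2) (hc'.intervalIntegrable _ _),
    intervalIntegral.integral_const_mul, hs,
    ← intervalIntegral.integral_interval_sub_left (hi 0 (β₁ * x₂)) (hi 0 (β₁ * x₁)),
    ← intervalIntegral.integral_interval_sub_left (hi 0 (κ * (β₁ * x₂))) (hi 0 (κ * (β₁ * x₁)))]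
  ring

theorem intervalIntegrable_two_mul_sub_div (hκ0 : 0 < κ) (hc : Continuous fun y => ω y t / y)
    (a b : ℝ) : IntervalIntegrable (fun y => (2 * ω y t - ω (κ * y) t) / y) volume a b := by
  refine Continuous.intervalIntegrable ?_ a b
  have := (hc.const_mul 2).sub ((hc.comp (continuous_const_mul κ)).const_mul κ)
  refine this.congr fun y => ?_
  simp only [Function.comp, Pi.sub_apply]
  field_simp

theorem AlmostOrdered.vel_div_sub_ge {M X Y : ℝ}
    (h : AlmostOrdered κ M X Y fun y => ω y t) (hw : ∀ y, 0 ≤ ω y t)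
    (hβ : β₂ = κ * β₁) (hκ : 1 / 2 < κ) (hκ1 : κ ≤ 1) (hβ₁ : 1 ≤ β₁)
    (hc : Continuous fun y => ω y t / y) (hM : 0 ≤ M) (hX : 0 < X) (hXY : β₁ * X ≤ Y)
    (hY : Y ≤ 1) {x₁ x₂ : ℝ} (h1 : 0 < x₁) (h12 : x₁ ≤ x₂) (h2 : x₂ ≤ X) :
    -(2 * M * (x₂ / x₁)) ≤ vel β₁ β₂ ω x₂ t / x₂ - vel β₁ β₂ ω x₁ t / x₁ := by
  have hβx : β₁ * x₂ ≤ β₁ * X := by gcongr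
  have hβ12 : β₁ * x₁ ≤ β₁ * x₂ := by gcongr
  have hp : 0 < β₁ * x₁ := by positivity
  rw [vel_div_sub_vel_div hβ (by linarith) hκ1 hβ₁ hc h1 h12 (by linarith)]
  have hmono : ∫ _ in (β₁ * x₁)..(β₁ * x₂), -(2 * M / (β₁ * x₁))
      ≤ ∫ y in (β₁ * x₁)..(β₁ * x₂), (2 * ω y t - ω (κ * y) t) / y := by
    refine intervalIntegral.integral_mono_on hβ12 (by simp)
      (intervalIntegrable_two_mul_sub_div (by linarith) hc _ _) fun y hy => ?_
    have hy0 : 0 < y := hp.trans_le hy.1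
    have := h.neg_two_mul_le hw hκ hκ1 hM hX hXY hy0 (hy.2.trans hβx)
    calc -(2 * M / (β₁ * x₁)) ≤ -(2 * M / y) := by
          have := hy.1
          gcongr
      _ = -(2 * M) / y := by ring
      _ ≤ _ := by gcongr
  refine le_trans ?_ hmono
  rw [intervalIntegral.integral_const, smul_eq_mul]
  have : (β₁ * x₂ - β₁ * x₁) * -(2 * M / (β₁ * x₁)) = -(2 * M * (x₂ / x₁)) + 2 * M := by
    field_simp
    ring
  rw [this]
  linarith

theorem neg_le_vel {A x : ℝ} (hβ21 : β₂ ≤ β₁) (hβ₁ : 1 ≤ β₁)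
    (hw : ∀ y, 0 ≤ ω y t) (hc : Continuous fun y => ω y t / y) (hβ₂ : 0 < β₂)
    (hx : 0 < x) (hx1 : x < 1) (hA : ∀ y, x ≤ y → ω y t ≤ A) : -A ≤ vel β₁ β₂ ω x t := by
  have hA0 : 0 ≤ A := (hw x).trans (hA x le_rfl)
  have h1 : 0 ≤ ∫ y in (min (β₂ * x) 1)..(min (β₁ * x) 1), ω y t / y := by
    refine intervalIntegral.integral_nonneg (by gcongr) fun y hy => ?_
    have : 0 < min (β₂ * x) 1 := by positivity
    exact div_nonneg (hw y) (this.le.trans hy.1)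
  have hm : x ≤ min (β₁ * x) 1 := le_min (by nlinarith) hx1.le
  have h2 : ∫ y in (min (β₁ * x) 1)..(1:ℝ), ω y t / y
      ≤ ∫ _ in (min (β₁ * x) 1)..(1:ℝ), A / x := by
    refine intervalIntegral.integral_mono_on (min_le_right _ _) (hc.intervalIntegrable _ _)
      (by simp) fun y hy => ?_
    have hxy := hm.trans hy.1
    have := hA y hxy
    gcongr
  rw [intervalIntegral.integral_const, smul_eq_mul] at h2
  have h3 : x * ∫ y in (min (β₁ * x) 1)..(1:ℝ), ω y t / y ≤ A := by
    calc _ ≤ x * ((1 - min (β₁ * x) 1) * (A / x)) := by gcongr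
      _ = (1 - min (β₁ * x) 1) * A := by field_simp
      _ ≤ 1 * A := by gcongr; linarith
      _ = A := one_mul A
  have h4 : 0 ≤ x * ∫ y in (min (β₂ * x) 1)..(min (β₁ * x) 1), ω y t / y := by positivity
  rw [vel]
  linarith

theorem AlmostOrdered.vel_nonpos {X Y : ℝ}
    (h : AlmostOrdered κ 0 X Y fun y => ω y t) (hw : ∀ y, 0 ≤ ω y t)
    (hβ : β₂ = κ * β₁) (hκ : 1 / 2 < κ) (hκ1 : κ ≤ 1) (hβ₁ : 1 ≤ β₁) (hβ₁2 : β₁ ≤ 2)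
    (hβ₂1 : β₂ ≤ 1)
    (hc : Continuous fun y => ω y t / y) (hX : 0 < X) (hXY : 32 * X ≤ Y)
    (hY : Y ≤ 1) : vel β₁ β₂ ω X t ≤ 0 := by
  have hβ1X : β₁ * X ≤ 2 * X := by gcongr
  have hβ21 : β₂ ≤ β₁ := by linarith
  have hβ₂ : 0 < β₂ := by rw [hβ]; nlinarith
  have hp : 0 < β₂ * X := by positivity
  have h1 : ∫ y in (β₂ * X)..(β₁ * X), ω y t / y ≤ ∫ _ in (β₂ * X)..(β₁ * X), 2 / (β₂ * X) := by
    refine intervalIntegral.integral_mono_on (by gcongr) (hc.intervalIntegrable _ _)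
      (by simp) fun y hy => ?_
    have hy0 := hp.trans_le hy.1
    have : ω y t ≤ 2 := by
      rcases le_or_gt y X with hyX | hyX
      · have h1 := h.order y X hy0 hyX le_rfl
        have h2 := h.outer_le X le_rfl
        simp only [add_zero] at h1 h2
        have h3 : (β₂ * X) * ω y t ≤ X * (2 * κ) := by
          have := mul_le_mul_of_nonneg_right hy.1 (hw y)
          nlinarith
        have h4 : X * (β₂ * ω y t) ≤ X * (2 * κ) := by linarith
        have h5 := le_of_mul_le_mul_left h4 hX
        rw [hβ] at h5
        have h6 : κ * (β₁ * ω y t) ≤ κ * 2 := by linarith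
        have h7 := le_of_mul_le_mul_left h6 (by linarith)
        nlinarith [hw y]
      · have := h.outer_le y hyX.le
        linarith
    have := hy.1
    gcongr
  have h2 : ∫ y in (2 * X)..(32 * X), 1 / y ≤ ∫ y in (β₁ * X)..(1:ℝ), ω y t / y := by
    calc ∫ y in (2 * X)..(32 * X), 1 / y ≤ ∫ y in (2 * X)..(32 * X), ω y t / y := by
          refine intervalIntegral.integral_mono_on (by linarith) ?_ (hc.intervalIntegrable _ _)
            fun y hy => ?_
          · refine intervalIntegral.intervalIntegrable_one_div (fun y hy => ?_) continuousOn_id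
            rw [Set.uIcc_of_le (by linarith)] at hy
            exact (show 0 < y by linarith [hy.1]).ne'
          · have hy0 : 0 < y := by linarith [hy.1]
            have := h.outer_ge y (by linarith [hy.1]) (hy.2.trans hXY)
            gcongr
      _ ≤ _ := by
          refine intervalIntegral.integral_mono_interval hβ1X (by linarith) (by linarith)
            ?_ (hc.intervalIntegrable _ _)
          refine (ae_restrict_iff' measurableSet_Ioc).2 (ae_of_all _ fun y hy => ?_)
          have : 0 < y := lt_of_le_of_lt (by positivity) hy.1
          exact div_nonneg (hw y) this.le
  rw [integral_one_div_of_pos (by positivity) (by positivity)] at h2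
  have h3 : 32 * X / (2 * X) = 2 ^ 4 := by field_simp; norm_num
  rw [h3, Real.log_pow] at h2
  rw [intervalIntegral.integral_const, smul_eq_mul] at h1
  have h4 : (β₁ * X - β₂ * X) * (2 / (β₂ * X)) ≤ 2 := by
    rw [← mul_div_assoc, div_le_iff₀ hp]
    have : β₁ ≤ 2 * β₂ := by rw [hβ]; nlinarith
    nlinarith
  have h5 := Real.log_two_gt_d9
  have h6 : β₂ * X ≤ β₁ * X := by gcongr
  rw [vel, min_eq_left (by linarith), min_eq_left (by linarith), ← mul_sub]
  refine mul_nonpos_of_nonneg_of_nonpos hX.le ?_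
  push_cast at h2
  linarith

theorem AlmostOrdered.vel_le {X Y x : ℝ}
    (h : AlmostOrdered κ 0 X Y fun y => ω y t) (hw : ∀ y, 0 ≤ ω y t)
    (hβ : β₂ = κ * β₁) (hκ : 1 / 2 < κ) (hκ1 : κ ≤ 1) (hβ₁ : 1 ≤ β₁) (hβ₁2 : β₁ ≤ 2)
    (hβ₂1 : β₂ ≤ 1)
    (hc : Continuous fun y => ω y t / y) (hX : 0 < X) (hXY : 32 * X ≤ Y)
    (hY : Y ≤ 1) (hx : 0 < x) (hxX : 4 * x ≤ X) :
    vel β₁ β₂ ω x t / x ≤ -((2 - 1 / κ) / 8 * ω x t) := by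
  have hvX := h.vel_nonpos hw hβ hκ hκ1 hβ₁ hβ₁2 hβ₂1 hc hX hXY hY
  have hvX' : vel β₁ β₂ ω X t / X ≤ 0 := div_nonpos_of_nonpos_of_nonneg hvX hX.le
  have hβ1X : β₁ * X ≤ 2 * X := by gcongr
  have hβ1x : β₁ * x ≤ 2 * x := by gcongr
  have h1x : x ≤ β₁ * x := by nlinarith
  have h1X : X ≤ β₁ * X := by nlinarith
  have hp : 0 < β₁ * x := by positivity
  have hκ0 : 0 < κ := by linarith
  have hc0 : 0 ≤ 2 - 1 / κ := by
    have : 1 / κ ≤ 2 := by rw [div_le_iff₀ hκ0]; linarith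
    linarith
  have hdiff := vel_div_sub_vel_div hβ (by linarith) hκ1 hβ₁ hc hx (by linarith : x ≤ X)
    (by linarith)
  set C := (2 - 1 / κ) * (ω x t / (2 * β₁)) / (2 * (β₁ * x)) with hC
  have hint := intervalIntegrable_two_mul_sub_div (ω := ω) (t := t) hκ0 hc
  have h1 : ∫ _ in (β₁ * x)..(2 * (β₁ * x)), C
      ≤ ∫ y in (β₁ * x)..(2 * (β₁ * x)), (2 * ω y t - ω (κ * y) t) / y := by
    refine intervalIntegral.integral_mono_on (by linarith) (by simp) (hint _ _) fun y hy => ?_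
    have hy0 : 0 < y := hp.trans_le hy.1
    have hyX : y ≤ X := by linarith [hy.2]
    have ha := h.order (κ * y) y (by positivity) (by nlinarith) hyX
    have hb := h.order x y hx (by linarith [hy.1]) hyX
    simp only [add_zero] at ha hb
    have ha' : κ * ω (κ * y) t ≤ ω y t := by
      refine le_of_mul_le_mul_left ?_ hy0
      linarith
    have ha'' : ω (κ * y) t ≤ 1 / κ * ω y t := by
      rw [one_div, ← div_eq_inv_mul, le_div_iff₀ hκ0]
      linarith
    have hb' : ω x t / (2 * β₁) ≤ ω y t := by
      rw [div_le_iff₀ (by positivity)]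
      refine le_of_mul_le_mul_left ?_ hx
      have := mul_le_mul_of_nonneg_right hy.2 (hw y)
      nlinarith
    have hnum : (2 - 1 / κ) * (ω x t / (2 * β₁)) ≤ 2 * ω y t - ω (κ * y) t := by
      have := mul_le_mul_of_nonneg_left hb' hc0
      linarith
    have hn0 : 0 ≤ (2 - 1 / κ) * (ω x t / (2 * β₁)) := by
      have := hw x
      positivity
    have hn1 := hn0.trans hnum
    have := hy.2
    rw [hC]
    gcongr
  have h2 : ∫ y in (β₁ * x)..(2 * (β₁ * x)), (2 * ω y t - ω (κ * y) t) / y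
      ≤ ∫ y in (β₁ * x)..(β₁ * X), (2 * ω y t - ω (κ * y) t) / y := by
    refine intervalIntegral.integral_mono_interval le_rfl (by linarith) (by linarith)
      ?_ (hint _ _)
    refine (ae_restrict_iff' measurableSet_Ioc).2 (ae_of_all _ fun y hy => ?_)
    have hy0 : 0 < y := hp.trans hy.1
    have := h.neg_two_mul_le hw hκ hκ1 le_rfl hX (by linarith : β₁ * X ≤ Y) hy0 hy.2
    refine div_nonneg (by linarith) hy0.le
  rw [intervalIntegral.integral_const, smul_eq_mul] at h1
  have h3 : (2 * (β₁ * x) - β₁ * x) * C = (2 - 1 / κ) * ω x t / (4 * β₁) := by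
    rw [hC]; field_simp; ring
  have h4 : (2 - 1 / κ) / 8 * ω x t ≤ (2 - 1 / κ) * ω x t / (4 * β₁) := by
    rw [le_div_iff₀ (by positivity)]
    nlinarith [mul_nonneg hc0 (hw x)]
  linarith

end FixedTime

section Calculus

theorem monotoneOn_Icc_of_hasDerivWithinAt_Ico {f f' : ℝ → ℝ} {s T : ℝ} (hs : s < T)
    (hf : ∀ t ∈ Set.Icc 0 s, HasDerivWithinAt f (f' t) (Set.Ico 0 T) t)
    (hf' : ∀ t ∈ Set.Icc 0 s, 0 ≤ f' t) : MonotoneOn f (Set.Icc 0 s) := by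
  have hsub : Set.Icc 0 s ⊆ Set.Ico 0 T := fun t ht => ⟨ht.1, ht.2.trans_lt hs⟩
  refine monotoneOn_of_hasDerivWithinAt_nonneg (convex_Icc 0 s)
    (fun t ht => (hf t ht).continuousWithinAt.mono hsub)
    (fun t ht => (hf t (interior_subset ht)).mono (interior_subset.trans hsub))
    fun t ht => hf' t (interior_subset ht)

theorem pos_on_Icc_of_continuation {f : ℝ → ℝ} {s : ℝ} (hf : ContinuousOn f (Set.Icc 0 s))
    (h0 : 0 < f 0)
    (hstep : ∀ r ∈ Set.Icc 0 s, (∀ q ∈ Set.Icc 0 r, 0 ≤ f q) → 0 < f r) :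
    ∀ r ∈ Set.Icc 0 s, 0 < f r := by
  by_contra! hcon
  obtain ⟨r, hr, hfr⟩ := hcon
  have hcl : IsClosed (Set.Icc 0 s ∩ f ⁻¹' Set.Iic 0) :=
    hf.preimage_isClosed_of_isClosed isClosed_Icc isClosed_Iic
  have hbdd : BddBelow (Set.Icc 0 s ∩ f ⁻¹' Set.Iic 0) := ⟨0, fun x hx => hx.1.1⟩
  have hmem := hcl.csInf_mem ⟨r, hr, hfr⟩ hbdd
  set c := sInf (Set.Icc 0 s ∩ f ⁻¹' Set.Iic 0) with hc
  have hlt : ∀ q ∈ Set.Ico 0 c, 0 < f q := by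
    intro q hq
    by_contra! hq0
    have : c ≤ q := csInf_le hbdd ⟨⟨hq.1, hq.2.le.trans hmem.1.2⟩, hq0⟩
    linarith [hq.2]
  have hc0 : 0 < c := by
    rcases hmem.1.1.eq_or_lt with h | h
    · have := hmem.2
      rw [Set.mem_preimage, ← h] at this
      exact absurd h0 (not_lt.2 this)
    · exact h
  have hfc : 0 ≤ f c := by
    have hcont : ContinuousOn f (Set.Icc 0 c) :=
      hf.mono (Set.Icc_subset_Icc_right hmem.1.2)
    have := ContinuousWithinAt.closure_le (s := Set.Ico 0 c) (f := fun _ => (0 : ℝ)) (g := f)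
      (x := c) (by rw [closure_Ico hc0.ne]; exact ⟨hc0.le, le_rfl⟩) continuousWithinAt_const
      ((hcont c ⟨hc0.le, le_rfl⟩).mono Set.Ico_subset_Icc_self) fun y hy => (hlt y hy).le
    exact this
  have := hstep c hmem.1 fun q hq => by
    rcases hq.2.eq_or_lt with h | h
    · rwa [h]
    · exact (hlt q ⟨hq.1, h⟩).le
  exact absurd this (not_lt.2 hmem.2)

theorem hasDerivWithinAt_along_curve {f : ℝ → ℝ → ℝ} {x : ℝ → ℝ} {v t T : ℝ}
    (hf : ContDiffOn ℝ 1 (fun p : ℝ × ℝ => f p.1 p.2) (Set.Ioo 0 1 ×ˢ Set.Ico 0 T))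
    (hx : HasDerivWithinAt x v (Set.Ico 0 T) t) (hmem : ∀ s ∈ Set.Ico 0 T, x s ∈ Set.Ioo 0 1)
    (ht : t ∈ Set.Ico 0 T) :
    HasDerivWithinAt (fun s => f (x s) s)
      (derivWithin (fun s => f (x t) s) (Set.Ico 0 T) t + v * deriv (fun y => f y t) (x t))
      (Set.Ico 0 T) t := by
  have hT : (0 : ℝ) < T := ht.1.trans_lt ht.2
  obtain ⟨F', hF⟩ : ∃ F', HasFDerivWithinAt (fun p : ℝ × ℝ => f p.1 p.2) F'
      (Set.Ioo 0 1 ×ˢ Set.Ico 0 T) (x t, t) :=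
    ⟨_, ((hf.differentiableOn one_ne_zero) (x t, t) ⟨hmem t ht, ht⟩).hasFDerivWithinAt⟩
  have h1 : HasDerivWithinAt (fun s => f (x s) s) (F' (v, 1)) (Set.Ico 0 T) t :=
    HasFDerivWithinAt.comp_hasDerivWithinAt (f := fun s => (x s, s)) t hF
      (hx.prodMk (hasDerivWithinAt_id t _)) fun s hs => ⟨hmem s hs, hs⟩
  have h2 : HasDerivWithinAt (fun y => f y t) (F' (1, 0)) (Set.Ioo 0 1) (x t) :=
    HasFDerivWithinAt.comp_hasDerivWithinAt (f := fun y => (y, t)) (x t) hF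
      ((hasDerivWithinAt_id (x t) _).prodMk (hasDerivWithinAt_const (x t) _ t))
      fun y hy => ⟨hy, ht⟩
  have h3 : HasDerivWithinAt (fun s => f (x t) s) (F' (0, 1)) (Set.Ico 0 T) t :=
    HasFDerivWithinAt.comp_hasDerivWithinAt (f := fun s => (x t, s)) t hF
      ((hasDerivWithinAt_const t _ (x t)).prodMk (hasDerivWithinAt_id t _))
      fun s hs => ⟨hmem t ht, hs⟩
  have h4 := h2.hasDerivAt (isOpen_Ioo.mem_nhds (hmem t ht))
  rw [h4.deriv, h3.derivWithin (uniqueDiffOn_Ico 0 T t ht)]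
  convert h1 using 1
  have : ((v, 1) : ℝ × ℝ) = (0, 1) + v • (1, 0) := by simp
  rw [this, map_add, map_smul, smul_eq_mul]

theorem false_of_riccati {Φ W v : ℝ → ℝ} {c s T : ℝ} (hc : 0 < c) (hs0 : 0 < s) (hs : s < T)
    (hpos : ∀ t ∈ Set.Icc 0 s, 0 < Φ t)
    (hΦ : ∀ t ∈ Set.Icc 0 s, HasDerivWithinAt Φ (v t) (Set.Ico 0 T) t)
    (hW : ∀ t ∈ Set.Icc 0 s, HasDerivWithinAt W (1 / Φ t) (Set.Ico 0 T) t)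
    (hv : ∀ t ∈ Set.Icc 0 s, v t / Φ t ≤ -(2 * c * W t)) (hW0 : W 0 = 1)
    (hbig : c * (1 + (2 / (c * s)) ^ 2) ≤ 1 / Φ 0) : False := by
  have h0 : (0 : ℝ) ∈ Set.Icc 0 s := ⟨le_rfl, hs0.le⟩
  have hss : s ∈ Set.Icc 0 s := ⟨hs0.le, le_rfl⟩
  set R := 2 / (c * s) with hR
  have hRpos : 0 < R := by positivity
  have hW1 : ∀ t ∈ Set.Icc 0 s, 1 ≤ W t := fun t ht => by
    rw [← hW0]
    exact monotoneOn_Icc_of_hasDerivWithinAt_Ico hs hW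
      (fun t ht => (one_div_pos.2 (hpos t ht)).le) h0 ht ht.1
  have hq : ∀ t ∈ Set.Icc 0 s, c * (W t ^ 2 + R ^ 2) ≤ 1 / Φ t := fun t ht => by
    have := monotoneOn_Icc_of_hasDerivWithinAt_Ico (f := fun t => (Φ t)⁻¹ - c * W t ^ 2)
      (f' := fun t => -v t / Φ t ^ 2 - c * (2 * W t ^ (2 - 1) * (1 / Φ t))) hs
      (fun t ht => ((hΦ t ht).inv (hpos t ht).ne').sub (((hW t ht).pow 2).const_mul c))
      (fun t ht => by
        have hp := hpos t ht
        have h1 : -v t / Φ t ^ 2 - c * (2 * W t ^ (2 - 1) * (1 / Φ t))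
            = (-(2 * c * W t) - v t / Φ t) / Φ t := by
          field_simp
          ring
        rw [h1]
        exact div_nonneg (by linarith [hv t ht]) hp.le) h0 ht ht.1
    simp only [hW0, ← one_div] at this
    linarith
  have := monotoneOn_Icc_of_hasDerivWithinAt_Ico (f := fun t => -(W t + R)⁻¹ - c / 2 * t)
    (f' := fun t => -(-(1 / Φ t) / (W t + R) ^ 2) - c / 2 * 1) hs
    (fun t ht => ((((hW t ht).add_const R).inv (by linarith [hW1 t ht])).neg).sub
      ((hasDerivWithinAt_id t _).const_mul (c / 2)))
    (fun t ht => by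
      have h1 := hW1 t ht
      have h2 : c / 2 ≤ 1 / Φ t / (W t + R) ^ 2 := by
        rw [le_div_iff₀ (by positivity)]
        nlinarith [hq t ht, mul_nonneg hc.le (sq_nonneg (W t - R))]
      rw [neg_div]
      linarith) h0 hss hs0.le
  simp only [hW0] at this
  have h1 : 0 < (W s + R)⁻¹ := inv_pos.2 (by linarith [hW1 s hss])
  have h2 : (1 + R)⁻¹ ≤ R⁻¹ := by gcongr; linarith
  have h3 : R⁻¹ = c / 2 * s := by rw [hR]; field_simp
  linarith

end Calculus

namespace IsClassicalSolution

variable {β₁ β₂ T : ℝ} {ω ρ Φ : ℝ → ℝ → ℝ}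

theorem continuous_omega_div (h : IsClassicalSolution β₁ β₂ T ω ρ Φ) {t : ℝ}
    (ht : t ∈ Set.Ico 0 T) : Continuous fun y => ω y t / y := by
  obtain ⟨a, b, ha, hab, hb, hsupp⟩ := h.supp t ht.1 ht.2
  rw [continuous_iff_continuousAt]
  intro y
  by_cases hy : y ∈ Set.Icc a b
  · have hy' : y ∈ Set.Ioo (0 : ℝ) 1 := ⟨ha.trans_le hy.1, hy.2.trans_lt hb⟩
    have h1 : ContinuousOn (fun y => ω y t) (Set.Ioo 0 1) :=
      h.omega_smooth.continuousOn.comp (f := fun y => (y, t)) (by fun_prop)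
        fun y hy => ⟨hy, ht⟩
    exact (h1.continuousAt (isOpen_Ioo.mem_nhds hy')).div continuousAt_id hy'.1.ne'
  · refine continuousAt_const (y := (0 : ℝ)) |>.congr ?_
    filter_upwards [isClosed_Icc.isOpen_compl.mem_nhds hy] with z hz
    rw [(hsupp z hz).1, zero_div]

theorem flow_mem (h : IsClassicalSolution β₁ β₂ T ω ρ Φ) {a t : ℝ} (ha : a ∈ Set.Ioo (0 : ℝ) 1)
    (ht : t ∈ Set.Ico 0 T) : Φ a t ∈ Set.Ioo (0 : ℝ) 1 :=
  (h.flow_bij t ht.1 ht.2).mapsTo ha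

theorem flow_le_flow_iff (h : IsClassicalSolution β₁ β₂ T ω ρ Φ) {a b t : ℝ}
    (ha : a ∈ Set.Ioo (0 : ℝ) 1) (hb : b ∈ Set.Ioo (0 : ℝ) 1) (ht : t ∈ Set.Ico 0 T) :
    Φ a t ≤ Φ b t ↔ a ≤ b :=
  (h.flow_mono t ht.1 ht.2).le_iff_le ha hb

theorem exists_label (h : IsClassicalSolution β₁ β₂ T ω ρ Φ) {x t : ℝ}
    (hx : x ∈ Set.Ioo (0 : ℝ) 1) (ht : t ∈ Set.Ico 0 T) :
    ∃ a ∈ Set.Ioo (0 : ℝ) 1, Φ a t = x :=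
  (h.flow_bij t ht.1 ht.2).surjOn hx

theorem hasDerivWithinAt_flow (h : IsClassicalSolution β₁ β₂ T ω ρ Φ) {a t : ℝ}
    (ha : a ∈ Set.Ioo (0 : ℝ) 1) (ht : t ∈ Set.Ico 0 T) :
    HasDerivWithinAt (fun s => Φ a s) (vel β₁ β₂ ω (Φ a t) t) (Set.Ico 0 T) t :=
  h.flow_deriv a ha t ht.1 ht.2

theorem rho_flow (h : IsClassicalSolution β₁ β₂ T ω ρ Φ) {a t : ℝ} (ha : a ∈ Set.Ioo (0 : ℝ) 1)
    (ht : t ∈ Set.Ico 0 T) : ρ (Φ a t) t = ρ a 0 := by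
  have hd : ∀ s ∈ Set.Icc 0 t, HasDerivWithinAt (fun s => ρ (Φ a s) s) 0 (Set.Ico 0 T) s := by
    intro s hs
    have hs' : s ∈ Set.Ico 0 T := ⟨hs.1, hs.2.trans_lt ht.2⟩
    have := hasDerivWithinAt_along_curve h.rho_smooth (h.hasDerivWithinAt_flow ha hs')
      (fun r hr => h.flow_mem ha hr) hs'
    rwa [h.rho_eq _ (h.flow_mem ha hs') s hs'.1 hs'.2] at this
  have h0 : (0 : ℝ) ∈ Set.Icc 0 t := ⟨le_rfl, ht.1⟩
  have h1 : t ∈ Set.Icc 0 t := ⟨ht.1, le_rfl⟩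
  have hle := monotoneOn_Icc_of_hasDerivWithinAt_Ico ht.2 hd (fun _ _ => le_rfl) h0 h1 ht.1
  have hge := monotoneOn_Icc_of_hasDerivWithinAt_Ico ht.2 (fun s hs => (hd s hs).neg)
    (fun _ _ => neg_zero.ge) h0 h1 ht.1
  simp only [Pi.neg_apply, h.flow_init a ha] at hle hge
  linarith

theorem hasDerivWithinAt_omega_flow (h : IsClassicalSolution β₁ β₂ T ω ρ Φ) {a t : ℝ}
    (ha : a ∈ Set.Ioo (0 : ℝ) 1) (ht : t ∈ Set.Ico 0 T) :
    HasDerivWithinAt (fun s => ω (Φ a s) s) (ρ a 0 / Φ a t) (Set.Ico 0 T) t := by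
  have := hasDerivWithinAt_along_curve h.omega_smooth (h.hasDerivWithinAt_flow ha ht)
    (fun r hr => h.flow_mem ha hr) ht
  rwa [h.omega_eq _ (h.flow_mem ha ht) t ht.1 ht.2, h.rho_flow ha ht] at this

theorem omega_init_le_omega_flow (h : IsClassicalSolution β₁ β₂ T ω ρ Φ) {a t : ℝ}
    (ha : a ∈ Set.Ioo (0 : ℝ) 1) (ht : t ∈ Set.Ico 0 T) : ω a 0 ≤ ω (Φ a t) t := by
  have := monotoneOn_Icc_of_hasDerivWithinAt_Ico (f := fun s => ω (Φ a s) s)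
    (f' := fun s => ρ a 0 / Φ a s) ht.2
    (fun s hs => h.hasDerivWithinAt_omega_flow ha ⟨hs.1, hs.2.trans_lt ht.2⟩)
    (fun s hs => div_nonneg (h.rho_nonneg _ _)
      (h.flow_mem ha ⟨hs.1, hs.2.trans_lt ht.2⟩).1.le)
    (⟨le_rfl, ht.1⟩ : (0 : ℝ) ∈ Set.Icc 0 t) ⟨ht.1, le_rfl⟩ ht.1
  simpa only [h.flow_init a ha] using this

theorem omega_flow_le (h : IsClassicalSolution β₁ β₂ T ω ρ Φ) {a t m : ℝ}
    (ha : a ∈ Set.Ioo (0 : ℝ) 1) (ht : t ∈ Set.Ico 0 T) (hm : 0 < m)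
    (hma : ∀ s ∈ Set.Icc 0 t, m ≤ Φ a s) : ω (Φ a t) t ≤ ω a 0 + ρ a 0 / m * t := by
  have := monotoneOn_Icc_of_hasDerivWithinAt_Ico (f := fun s => ρ a 0 / m * s - ω (Φ a s) s)
    (f' := fun s => ρ a 0 / m * 1 - ρ a 0 / Φ a s) ht.2
    (fun s hs => ((hasDerivWithinAt_id s _).const_mul _).sub
      (h.hasDerivWithinAt_omega_flow ha ⟨hs.1, hs.2.trans_lt ht.2⟩))
    (fun s hs => by
      have h1 := hma s hs
      have h2 : ρ a 0 / Φ a s ≤ ρ a 0 / m := div_le_div_of_nonneg_left (h.rho_nonneg _ _) hm h1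
      linarith)
    (⟨le_rfl, ht.1⟩ : (0 : ℝ) ∈ Set.Icc 0 t) ⟨ht.1, le_rfl⟩ ht.1
  simp only [h.flow_init a ha] at this
  linarith

theorem exists_flow_ge (h : IsClassicalSolution β₁ β₂ T ω ρ Φ) {a t : ℝ}
    (ha : a ∈ Set.Ioo (0 : ℝ) 1) (ht : t ∈ Set.Ico 0 T) :
    ∃ m, 0 < m ∧ ∀ s ∈ Set.Icc 0 t, m ≤ Φ a s := by
  have hsub : Set.Icc 0 t ⊆ Set.Ico 0 T := fun s hs => ⟨hs.1, hs.2.trans_lt ht.2⟩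
  have hc : ContinuousOn (fun s => Φ a s) (Set.Icc 0 t) := fun s hs =>
    (h.hasDerivWithinAt_flow ha (hsub hs)).continuousWithinAt.mono hsub
  obtain ⟨s, hs, hmin⟩ := isCompact_Icc.exists_isMinOn ⟨t, ht.1, le_rfl⟩ hc
  exact ⟨Φ a s, (h.flow_mem ha (hsub hs)).1, fun r hr => hmin hr⟩

end IsClassicalSolution

/-- A profile in `[0, 1]` vanishing on `(0, a₀)`, nondecreasing on `(0, 1/128]` and equal to `1`
on `[1/128, 1/2]`. -/
structure IsPlateau (a₀ : ℝ) (ψ : ℝ → ℝ) : Prop where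
  nonneg : ∀ x, 0 ≤ ψ x
  le_one : ∀ x, ψ x ≤ 1
  mono : MonotoneOn ψ (Set.Ioc 0 (1 / 128))
  eq_one : ∀ x, 1 / 128 ≤ x → x ≤ 1 / 2 → ψ x = 1
  eq_zero : ∀ x, 0 < x → x < a₀ → ψ x = 0

theorem almostOrdered_of_labels {β₁ β₂ T κ M t : ℝ} {ω ρ Φ : ℝ → ℝ → ℝ}
    (h : IsClassicalSolution β₁ β₂ T ω ρ Φ) (ht : t ∈ Set.Ico 0 T)
    (hord : ∀ a ∈ Set.Ioo (0 : ℝ) 1, ∀ b ∈ Set.Ioo (0 : ℝ) 1, a ≤ b → b ≤ 1 / 128 →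
      Φ a t * ω (Φ a t) t ≤ Φ b t * (ω (Φ b t) t + M))
    (hle : ∀ y, Φ (1 / 128) t ≤ y → ω y t ≤ 2 * κ)
    (hge : ∀ y, Φ (1 / 128) t ≤ y → y ≤ Φ (1 / 2) t → 1 ≤ ω y t) :
    AlmostOrdered κ M (Φ (1 / 128) t) (Φ (1 / 2) t) fun y => ω y t where
  outer_le := hle
  outer_ge := hge
  order x y hx hxy hy := by
    have hX := h.flow_mem (a := 1 / 128) (by norm_num) ht
    obtain ⟨a, ha, rfl⟩ := h.exists_label ⟨hx, (hxy.trans hy).trans_lt hX.2⟩ ht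
    obtain ⟨b, hb, rfl⟩ := h.exists_label ⟨hx.trans_le hxy, hy.trans_lt hX.2⟩ ht
    exact hord a ha b hb ((h.flow_le_flow_iff ha hb ht).1 hxy)
      ((h.flow_le_flow_iff hb (by norm_num) ht).1 hy)

section Plateau

variable {β₁ β₂ T κ a₀ s : ℝ} {ω ρ Φ : ℝ → ℝ → ℝ} {ψ : ℝ → ℝ}

theorem omega_outer_le (h : IsClassicalSolution β₁ β₂ T ω ρ Φ) (hψ : IsPlateau a₀ ψ)
    (hinit : ∀ x ∈ Set.Ioo (0 : ℝ) 1, ω x 0 = ψ x ∧ ρ x 0 = ψ x) (hs : s ∈ Set.Ico 0 T)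
    (hsκ : s ≤ (2 * κ - 1) / 1000) (hX : ∀ r ∈ Set.Icc 0 s, 1 / 256 ≤ Φ (1 / 128) r) {y : ℝ}
    (hy : Φ (1 / 128) s ≤ y) : ω y s ≤ 2 * κ := by
  have hκ : 0 ≤ 2 * κ := by linarith [hs.1]
  rcases le_or_gt 1 y with hy1 | hy1
  · obtain ⟨a, b, ha, hab, hb, hsupp⟩ := h.supp s hs.1 hs.2
    rw [(hsupp y fun hy' => by linarith [hy'.2]).1]
    exact hκ
  · have hmem : (1 / 128 : ℝ) ∈ Set.Ioo (0 : ℝ) 1 := by norm_num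
    have h0 := h.flow_mem hmem hs
    obtain ⟨c, hc, rfl⟩ := h.exists_label ⟨h0.1.trans_le hy, hy1⟩ hs
    have hc128 := (h.flow_le_flow_iff hmem hc hs).1 hy
    have := h.omega_flow_le hc hs (m := 1 / 256) (by norm_num) fun r hr =>
      (hX r hr).trans ((h.flow_le_flow_iff hmem hc ⟨hr.1, hr.2.trans_lt hs.2⟩).2 hc128)
    rw [(hinit c hc).1, (hinit c hc).2] at this
    have h1 := hψ.le_one c
    have h2 := hψ.nonneg c
    have h3 : ψ c / (1 / 256) * s ≤ 256 * s := by
      have : ψ c / (1 / 256) ≤ 256 := by linarith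
      exact mul_le_mul_of_nonneg_right this hs.1
    linarith [hs.1]

theorem one_le_omega_outer (h : IsClassicalSolution β₁ β₂ T ω ρ Φ) (hψ : IsPlateau a₀ ψ)
    (hinit : ∀ x ∈ Set.Ioo (0 : ℝ) 1, ω x 0 = ψ x ∧ ρ x 0 = ψ x) (hs : s ∈ Set.Ico 0 T) {y : ℝ}
    (hy : Φ (1 / 128) s ≤ y) (hy' : y ≤ Φ (1 / 2) s) : 1 ≤ ω y s := by
  have hmem : (1 / 128 : ℝ) ∈ Set.Ioo (0 : ℝ) 1 := by norm_num
  have hmem' : (1 / 2 : ℝ) ∈ Set.Ioo (0 : ℝ) 1 := by norm_num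
  obtain ⟨c, hc, rfl⟩ := h.exists_label ⟨(h.flow_mem hmem hs).1.trans_le hy,
    hy'.trans_lt (h.flow_mem hmem' hs).2⟩ hs
  have := h.omega_init_le_omega_flow hc hs
  rwa [(hinit c hc).1, hψ.eq_one c ((h.flow_le_flow_iff hmem hc hs).1 hy)
    ((h.flow_le_flow_iff hc hmem' hs).1 hy')] at this

theorem omega_flow_eq_zero (h : IsClassicalSolution β₁ β₂ T ω ρ Φ) (hψ : IsPlateau a₀ ψ)
    (hinit : ∀ x ∈ Set.Ioo (0 : ℝ) 1, ω x 0 = ψ x ∧ ρ x 0 = ψ x) (hs : s ∈ Set.Ico 0 T) {a : ℝ}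
    (ha : a ∈ Set.Ioo (0 : ℝ) 1) (haa : a < a₀) : ω (Φ a s) s = 0 := by
  obtain ⟨m, hm, hma⟩ := h.exists_flow_ge ha hs
  have := h.omega_flow_le ha hs hm hma
  rw [(hinit a ha).1, (hinit a ha).2, hψ.eq_zero a ha.1 haa] at this
  refine le_antisymm (by simpa using this) (h.omega_nonneg _ _)

theorem exists_omega_flow_le (h : IsClassicalSolution β₁ β₂ T ω ρ Φ) (hψ : IsPlateau a₀ ψ)
    (hinit : ∀ x ∈ Set.Ioo (0 : ℝ) 1, ω x 0 = ψ x ∧ ρ x 0 = ψ x) (hs : s ∈ Set.Ico 0 T)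
    (ha₀ : a₀ ∈ Set.Ioo (0 : ℝ) 1) :
    ∃ A, 0 < A ∧ ∀ r ∈ Set.Icc 0 s, ∀ a ∈ Set.Ioo (0 : ℝ) 1, ω (Φ a r) r ≤ A := by
  obtain ⟨m, hm, hma⟩ := h.exists_flow_ge ha₀ hs
  have hs0 : 0 ≤ s := hs.1
  refine ⟨1 + 1 / m * s, by positivity, fun r hr a ha => ?_⟩
  have hr' : r ∈ Set.Ico 0 T := ⟨hr.1, hr.2.trans_lt hs.2⟩
  rcases lt_or_ge a a₀ with haa | haa
  · rw [omega_flow_eq_zero h hψ hinit hr' ha haa]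
    positivity
  · have := h.omega_flow_le ha hr' hm fun q hq =>
      (hma q ⟨hq.1, hq.2.trans hr.2⟩).trans
        ((h.flow_le_flow_iff ha₀ ha ⟨hq.1, hq.2.trans_lt hr'.2⟩).2 haa)
    rw [(hinit a ha).1, (hinit a ha).2] at this
    refine this.trans ?_
    have h1 := hψ.le_one a
    have := hr.1
    have := hr.2
    gcongr

/-- The order defect, measured in an exponentially weighted norm, can be halved. -/
theorem almostOrdered_halve (h : IsClassicalSolution β₁ β₂ T ω ρ Φ) (hψ : IsPlateau a₀ ψ)
    (hinit : ∀ x ∈ Set.Ioo (0 : ℝ) 1, ω x 0 = ψ x ∧ ρ x 0 = ψ x) (hs : s ∈ Set.Ico 0 T)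
    (hβ : β₂ = κ * β₁) (hκ : 1 / 2 < κ) (hκ1 : κ ≤ 1) (hβ₁ : 1 ≤ β₁) (hβ₁2 : β₁ ≤ 2)
    (hXY : ∀ r ∈ Set.Icc 0 s, 32 * Φ (1 / 128) r ≤ Φ (1 / 2) r) {A M : ℝ} (hM : 0 ≤ M)
    (hωA : ∀ r ∈ Set.Icc 0 s, ∀ a ∈ Set.Ioo (0 : ℝ) 1, ω (Φ a r) r ≤ A)
    (hord : ∀ r ∈ Set.Icc 0 s, AlmostOrdered κ (M * Real.exp (4 * A * r)) (Φ (1 / 128) r)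
      (Φ (1 / 2) r) fun y => ω y r) :
    ∀ r ∈ Set.Icc 0 s, AlmostOrdered κ (M / 2 * Real.exp (4 * A * r)) (Φ (1 / 128) r)
      (Φ (1 / 2) r) fun y => ω y r := by
  intro r hr
  have hIco : ∀ q ∈ Set.Icc 0 s, q ∈ Set.Ico 0 T := fun q hq => ⟨hq.1, hq.2.trans_lt hs.2⟩
  have hmem : (1 / 128 : ℝ) ∈ Set.Ioo (0 : ℝ) 1 := by norm_num
  have hmem' : (1 / 2 : ℝ) ∈ Set.Ioo (0 : ℝ) 1 := by norm_num
  refine almostOrdered_of_labels h (hIco r hr) (fun a ha b hb hab hb128 => ?_)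
    (hord r hr).outer_le (hord r hr).outer_ge
  have hpa : ∀ q ∈ Set.Icc 0 s, 0 < Φ a q := fun q hq => (h.flow_mem ha (hIco q hq)).1
  have hpb : ∀ q ∈ Set.Icc 0 s, 0 < Φ b q := fun q hq => (h.flow_mem hb (hIco q hq)).1
  have key := monotoneOn_Icc_of_hasDerivWithinAt_Ico
    (f := fun q => ω (Φ b q) q - Φ a q / Φ b q * ω (Φ a q) q
      + M / 2 * Real.exp (4 * A * q))
    (f' := fun q => ρ b 0 / Φ b q - ((vel β₁ β₂ ω (Φ a q) q * Φ b q
        - Φ a q * vel β₁ β₂ ω (Φ b q) q) / Φ b q ^ 2 * ω (Φ a q) q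
          + Φ a q / Φ b q * (ρ a 0 / Φ a q))
      + M / 2 * (Real.exp (4 * A * q) * (4 * A * 1))) hs.2
    (fun q hq => ((h.hasDerivWithinAt_omega_flow hb (hIco q hq)).sub
      (((h.hasDerivWithinAt_flow ha (hIco q hq)).div (h.hasDerivWithinAt_flow hb (hIco q hq))
        (hpb q hq).ne').mul (h.hasDerivWithinAt_omega_flow ha (hIco q hq)))).add
      (((hasDerivWithinAt_id q _).const_mul (4 * A)).exp.const_mul (M / 2)))
    (fun q hq => by
      have hpa := hpa q hq
      have hpb := hpb q hq
      have hq' := hIco q hq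
      have hX := h.flow_mem hmem hq'
      have hβ1X : β₁ * Φ (1 / 128) q ≤ 32 * Φ (1 / 128) q := by
        have := hX.1
        gcongr
        linarith
      have hd := (hord q hq).vel_div_sub_ge (fun y => h.omega_nonneg y q) hβ hκ hκ1 hβ₁
        (h.continuous_omega_div hq') (by positivity) hX.1 (hβ1X.trans (hXY q hq))
        (h.flow_mem hmem' hq').2.le hpa ((h.flow_le_flow_iff ha hb hq').2 hab)
        ((h.flow_le_flow_iff hb hmem hq').2 hb128)
      set E := M * Real.exp (4 * A * q)
      have hE : 0 ≤ E := by positivity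
      have hWA := hωA q hq a ha
      have hW0 := h.omega_nonneg (Φ a q) q
      set W := ω (Φ a q) q
      have h1 : (vel β₁ β₂ ω (Φ a q) q * Φ b q - Φ a q * vel β₁ β₂ ω (Φ b q) q) / Φ b q ^ 2
          = Φ a q / Φ b q * (vel β₁ β₂ ω (Φ a q) q / Φ a q
            - vel β₁ β₂ ω (Φ b q) q / Φ b q) := by
        field_simp
      have h2 : Φ a q / Φ b q * (vel β₁ β₂ ω (Φ a q) q / Φ a q
            - vel β₁ β₂ ω (Φ b q) q / Φ b q) ≤ 2 * E := by
        calc _ ≤ Φ a q / Φ b q * (2 * E * (Φ b q / Φ a q)) := by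
              gcongr
              linarith
          _ = 2 * E := by field_simp
      have h3 : Φ a q / Φ b q * (ρ a 0 / Φ a q) ≤ ρ b 0 / Φ b q := by
        have : Φ a q / Φ b q * (ρ a 0 / Φ a q) = ρ a 0 / Φ b q := by field_simp
        rw [this, (hinit a ha).2, (hinit b hb).2]
        have := hψ.mono ⟨ha.1, hab.trans hb128⟩ ⟨hb.1, hb128⟩ hab
        gcongr
      have h4 : 2 * E * W ≤ 2 * E * A := by gcongr
      have h5 := mul_le_mul_of_nonneg_right h2 hW0
      rw [h1]
      have h6 : M / 2 * (Real.exp (4 * A * q) * (4 * A * 1)) = 2 * E * A := by ring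
      rw [h6]
      linarith)
    (⟨le_rfl, hs.1⟩ : (0 : ℝ) ∈ Set.Icc 0 s) hr hr.1
  simp only [h.flow_init a ha, h.flow_init b hb, (hinit a ha).1, (hinit b hb).1] at key
  have hψab := hψ.mono ⟨ha.1, hab.trans hb128⟩ ⟨hb.1, hb128⟩ hab
  have h1 : a / b * ψ a ≤ ψ b := by
    have : a / b ≤ 1 := by rw [div_le_one hb.1]; exact hab
    nlinarith [hψ.nonneg a]
  have h2 : 0 ≤ M / 2 * Real.exp (4 * A * 0) := by positivity
  have h3 : Φ a r / Φ b r * ω (Φ a r) r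
      ≤ ω (Φ b r) r + M / 2 * Real.exp (4 * A * r) := by linarith
  have hb := hpb r hr
  calc Φ a r * ω (Φ a r) r = Φ b r * (Φ a r / Φ b r * ω (Φ a r) r) := by field_simp
    _ ≤ _ := by gcongr

theorem almostOrdered_zero (h : IsClassicalSolution β₁ β₂ T ω ρ Φ) (hψ : IsPlateau a₀ ψ)
    (hinit : ∀ x ∈ Set.Ioo (0 : ℝ) 1, ω x 0 = ψ x ∧ ρ x 0 = ψ x) (hs : s ∈ Set.Ico 0 T)
    (ha₀ : a₀ ∈ Set.Ioo (0 : ℝ) 1)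
    (hβ : β₂ = κ * β₁) (hκ : 1 / 2 < κ) (hκ1 : κ ≤ 1) (hβ₁ : 1 ≤ β₁) (hβ₁2 : β₁ ≤ 2)
    (hsκ : s ≤ (2 * κ - 1) / 1000) (hX : ∀ r ∈ Set.Icc 0 s, 1 / 256 ≤ Φ (1 / 128) r)
    (hXY : ∀ r ∈ Set.Icc 0 s, 32 * Φ (1 / 128) r ≤ Φ (1 / 2) r) :
    ∀ r ∈ Set.Icc 0 s, AlmostOrdered κ 0 (Φ (1 / 128) r) (Φ (1 / 2) r) fun y => ω y r := by
  obtain ⟨A, hA, hωA⟩ := exists_omega_flow_le h hψ hinit hs ha₀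
  have hIco : ∀ q ∈ Set.Icc 0 s, q ∈ Set.Ico 0 T := fun q hq => ⟨hq.1, hq.2.trans_lt hs.2⟩
  have hle : ∀ r ∈ Set.Icc 0 s, ∀ y, Φ (1 / 128) r ≤ y → ω y r ≤ 2 * κ := fun r hr y hy =>
    omega_outer_le h hψ hinit (hIco r hr) (hr.2.trans hsκ)
      (fun q hq => hX q ⟨hq.1, hq.2.trans hr.2⟩) hy
  have hge : ∀ r ∈ Set.Icc 0 s, ∀ y, Φ (1 / 128) r ≤ y → y ≤ Φ (1 / 2) r → 1 ≤ ω y r :=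
    fun r hr y hy hy' => one_le_omega_outer h hψ hinit (hIco r hr) hy hy'
  have hn : ∀ n : ℕ, ∀ r ∈ Set.Icc 0 s, AlmostOrdered κ (A / 2 ^ n * Real.exp (4 * A * r))
      (Φ (1 / 128) r) (Φ (1 / 2) r) fun y => ω y r := by
    intro n
    induction n with
    | zero =>
      intro r hr
      refine almostOrdered_of_labels h (hIco r hr) (fun a ha b hb hab _ => ?_) (hle r hr)
        (hge r hr)
      have h1 := hωA r hr a ha
      have h2 := (h.flow_le_flow_iff ha hb (hIco r hr)).2 hab
      have h3 := (h.flow_mem hb (hIco r hr)).1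
      have h4 := h.omega_nonneg (Φ b r) r
      have h5 : 1 ≤ Real.exp (4 * A * r) := by
        have := hr.1
        exact Real.one_le_exp (by positivity)
      have h6 : ω (Φ a r) r ≤ ω (Φ b r) r + A / 2 ^ 0 * Real.exp (4 * A * r) := by
        rw [pow_zero, div_one]
        nlinarith
      exact mul_le_mul h2 h6 (h.omega_nonneg _ _) h3.le
    | succ n ih =>
      have := almostOrdered_halve h hψ hinit hs hβ hκ hκ1 hβ₁ hβ₁2 hXY (by positivity) hωA ih
      rwa [div_div, ← pow_succ] at this
  intro r hr
  refine ⟨fun x y hx hxy hy => ?_, hle r hr, hge r hr⟩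
  have hlim : Filter.Tendsto (fun n : ℕ => y * (ω y r + A / 2 ^ n * Real.exp (4 * A * r)))
      Filter.atTop (nhds (y * (ω y r + 0 * Real.exp (4 * A * r)))) := by
    refine (((Filter.Tendsto.mul_const _ ?_).const_add _).const_mul _)
    exact tendsto_const_nhds.div_atTop (tendsto_pow_atTop_atTop_of_one_lt one_lt_two)
  rw [zero_mul] at hlim
  exact ge_of_tendsto' hlim fun n => (hn n r hr).order x y hx hxy hy

theorem flow_plateau_bounds (h : IsClassicalSolution β₁ β₂ T ω ρ Φ) (hψ : IsPlateau a₀ ψ)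
    (hinit : ∀ x ∈ Set.Ioo (0 : ℝ) 1, ω x 0 = ψ x ∧ ρ x 0 = ψ x) (hs : s ∈ Set.Ico 0 T)
    (ha₀ : a₀ ∈ Set.Ioo (0 : ℝ) 1) (hβ : β₂ = κ * β₁) (hκ : 1 / 2 < κ) (hκ1 : κ ≤ 1)
    (hβ₁ : 1 ≤ β₁) (hβ₂1 : β₂ ≤ 1) (hβ₁2 : β₁ ≤ 2) (hsκ : s ≤ (2 * κ - 1) / 1000) :
    ∀ r ∈ Set.Icc 0 s, 1 / 256 ≤ Φ (1 / 128) r ∧ 32 * Φ (1 / 128) r ≤ Φ (1 / 2) r := by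
  have hsub : Set.Icc 0 s ⊆ Set.Ico 0 T := fun q hq => ⟨hq.1, hq.2.trans_lt hs.2⟩
  have hmem : (1 / 128 : ℝ) ∈ Set.Ioo (0 : ℝ) 1 := by norm_num
  have hmem' : (1 / 2 : ℝ) ∈ Set.Ioo (0 : ℝ) 1 := by norm_num
  have hβ21 : β₂ ≤ β₁ := by linarith
  have hβ₂ : 0 < β₂ := by rw [hβ]; nlinarith
  have hcont : ∀ a ∈ Set.Ioo (0 : ℝ) 1, ContinuousOn (fun r => Φ a r) (Set.Icc 0 s) :=
    fun a ha r hr => (h.hasDerivWithinAt_flow ha (hsub hr)).continuousWithinAt.mono hsub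
  have key := pos_on_Icc_of_continuation
    (f := fun r => min (Φ (1 / 128) r - 1 / 256) (Φ (1 / 2) r - 32 * Φ (1 / 128) r)) (s := s)
    (((hcont _ hmem).sub continuousOn_const).inf
      ((hcont _ hmem').sub (continuousOn_const.mul (hcont _ hmem))))
    (by rw [h.flow_init _ hmem, h.flow_init _ hmem']; norm_num)
    (fun r hr hq => by
      have hrT := hsub hr
      have hX : ∀ q ∈ Set.Icc 0 r, 1 / 256 ≤ Φ (1 / 128) q := fun q hq' => by
        have := (le_min_iff.1 (hq q hq')).1
        linarith
      have hXY : ∀ q ∈ Set.Icc 0 r, 32 * Φ (1 / 128) q ≤ Φ (1 / 2) q := fun q hq' => by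
        have := (le_min_iff.1 (hq q hq')).2
        linarith
      have hsub' : Set.Icc 0 r ⊆ Set.Ico 0 T := fun q hq => ⟨hq.1, hq.2.trans_lt hrT.2⟩
      have hord := almostOrdered_zero h hψ hinit hrT ha₀ hβ hκ hκ1 hβ₁ hβ₁2 (hr.2.trans hsκ)
        hX hXY
      have h0 : (0 : ℝ) ∈ Set.Icc 0 r := ⟨le_rfl, hr.1⟩
      have h1 : r ∈ Set.Icc 0 r := ⟨hr.1, le_rfl⟩
      have hlow : ∀ a ∈ Set.Ioo (0 : ℝ) 1, 1 / 128 ≤ a → a - 2 * r ≤ Φ a r := by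
        intro a ha ha128
        have := monotoneOn_Icc_of_hasDerivWithinAt_Ico (f := fun q => Φ a q + 2 * q)
          (f' := fun q => vel β₁ β₂ ω (Φ a q) q + 2 * 1) hrT.2
          (fun q hq => (h.hasDerivWithinAt_flow ha (hsub' hq)).add
            ((hasDerivWithinAt_id q _).const_mul 2))
          (fun q hq => by
            have hΦ := h.flow_mem ha (hsub' hq)
            have := neg_le_vel hβ21 hβ₁ (fun y => h.omega_nonneg y q)
              (h.continuous_omega_div (hsub' hq)) hβ₂ hΦ.1 hΦ.2 fun y hy =>
                (hord q hq).outer_le y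
                  (((h.flow_le_flow_iff hmem ha (hsub' hq)).2 ha128).trans hy)
            linarith) h0 h1 hr.1
        simp only [h.flow_init a ha] at this
        linarith
      have hup : Φ (1 / 128) r ≤ 1 / 128 := by
        have := monotoneOn_Icc_of_hasDerivWithinAt_Ico (f := fun q => -Φ (1 / 128) q)
          (f' := fun q => -vel β₁ β₂ ω (Φ (1 / 128) q) q) hrT.2
          (fun q hq => (h.hasDerivWithinAt_flow hmem (hsub' hq)).neg)
          (fun q hq => by
            have := (hord q hq).vel_nonpos (fun y => h.omega_nonneg y q) hβ hκ hκ1 hβ₁ hβ₁2 hβ₂1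
              (h.continuous_omega_div (hsub' hq)) (h.flow_mem hmem (hsub' hq)).1 (hXY q hq)
              (h.flow_mem hmem' (hsub' hq)).2.le
            linarith) h0 h1 hr.1
        simp only [h.flow_init _ hmem] at this
        linarith
      have hr1 : r ≤ 1 / 1000 := by linarith [hr.2]
      have hl1 := hlow _ hmem le_rfl
      have hl2 := hlow _ hmem' (by norm_num)
      exact lt_min (by linarith) (by linarith))
  intro r hr
  have := lt_min_iff.1 (key r hr)
  exact ⟨by linarith [this.1], by linarith [this.2]⟩

theorem lifespan_le (h : IsClassicalSolution β₁ β₂ T ω ρ Φ) (hψ : IsPlateau a₀ ψ)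
    (hinit : ∀ x ∈ Set.Ioo (0 : ℝ) 1, ω x 0 = ψ x ∧ ρ x 0 = ψ x)
    (ha₀ : a₀ ∈ Set.Ioo (0 : ℝ) 1) (hβ : β₂ = κ * β₁) (hκ : 1 / 2 < κ) (hκ1 : κ ≤ 1)
    (hβ₁ : 1 ≤ β₁) (hβ₂1 : β₂ ≤ 1) (hβ₁2 : β₁ ≤ 2) {a c : ℝ} (ha : 0 < a) (ha1 : a ≤ 1 / 1024)
    (hψa : ψ a = 1) (hc : c = (2 - 1 / κ) / 16) (hs : s = (2 * κ - 1) / 1000)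
    (hbig : c * (1 + (2 / (c * s)) ^ 2) ≤ 1 / a) : T ≤ s := by
  by_contra! hsT
  have hκ0 : 0 < κ := by linarith
  have hs0 : 0 < s := by rw [hs]; linarith
  have hc0 : 0 < c := by
    have : 1 / κ < 2 := by rw [div_lt_iff₀ hκ0]; linarith
    rw [hc]; linarith
  have hsI : s ∈ Set.Ico 0 T := ⟨hs0.le, hsT⟩
  have hsub : Set.Icc 0 s ⊆ Set.Ico 0 T := fun q hq => ⟨hq.1, hq.2.trans_lt hsT⟩
  have hmem : (1 / 128 : ℝ) ∈ Set.Ioo (0 : ℝ) 1 := by norm_num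
  have hmem' : (1 / 2 : ℝ) ∈ Set.Ioo (0 : ℝ) 1 := by norm_num
  have hb := flow_plateau_bounds h hψ hinit hsI ha₀ hβ hκ hκ1 hβ₁ hβ₂1 hβ₁2 hs.le
  have hord := almostOrdered_zero h hψ hinit hsI ha₀ hβ hκ hκ1 hβ₁ hβ₁2 hs.le
    (fun r hr => (hb r hr).1) fun r hr => (hb r hr).2
  have haI : a ∈ Set.Ioo (0 : ℝ) 1 := ⟨ha, by linarith⟩
  have hpos : ∀ r ∈ Set.Icc 0 s, 0 < Φ a r := fun r hr => (h.flow_mem haI (hsub hr)).1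
  have hvel : ∀ r ∈ Set.Icc 0 s, vel β₁ β₂ ω (Φ a r) r ≤ 0 := fun r hr => by
    have hX := h.flow_mem hmem (hsub hr)
    have h1 := (hord r hr).vel_nonpos (fun y => h.omega_nonneg y r) hβ hκ hκ1 hβ₁ hβ₁2 hβ₂1
      (h.continuous_omega_div (hsub hr)) hX.1 (hb r hr).2 (h.flow_mem hmem' (hsub hr)).2.le
    have hβX : β₁ * Φ (1 / 128) r ≤ Φ (1 / 2) r := by nlinarith [(hb r hr).2, hX.1]
    have h2 := (hord r hr).vel_div_sub_ge (fun y => h.omega_nonneg y r) hβ hκ hκ1 hβ₁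
      (h.continuous_omega_div (hsub hr)) le_rfl hX.1 hβX (h.flow_mem hmem' (hsub hr)).2.le
      (hpos r hr) ((h.flow_le_flow_iff haI hmem (hsub hr)).2 (by linarith)) le_rfl
    have h3 := div_nonpos_of_nonpos_of_nonneg h1 hX.1.le
    have h4 : vel β₁ β₂ ω (Φ a r) r / Φ a r ≤ 0 := by linarith
    rw [div_le_iff₀ (hpos r hr), zero_mul] at h4
    exact h4
  have hΦa : ∀ r ∈ Set.Icc 0 s, Φ a r ≤ 1 / 1024 := fun r hr => by
    have := monotoneOn_Icc_of_hasDerivWithinAt_Ico (f := fun q => -Φ a q)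
      (f' := fun q => -vel β₁ β₂ ω (Φ a q) q) hsT
      (fun q hq => (h.hasDerivWithinAt_flow haI (hsub hq)).neg)
      (fun q hq => neg_nonneg.2 (hvel q hq)) (⟨le_rfl, hs0.le⟩ : (0 : ℝ) ∈ Set.Icc 0 s) hr hr.1
    simp only [h.flow_init _ haI] at this
    linarith
  refine false_of_riccati (Φ := fun r => Φ a r) (W := fun r => ω (Φ a r) r)
    (v := fun r => vel β₁ β₂ ω (Φ a r) r) hc0 hs0 hsT hpos
    (fun r hr => h.hasDerivWithinAt_flow haI (hsub hr))
    (fun r hr => ?_) (fun r hr => ?_) ?_ ?_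
  · have := h.hasDerivWithinAt_omega_flow haI (hsub hr)
    rwa [(hinit a haI).2, hψa] at this
  · have := (hord r hr).vel_le (fun y => h.omega_nonneg y r) hβ hκ hκ1 hβ₁ hβ₁2 hβ₂1
      (h.continuous_omega_div (hsub hr)) (h.flow_mem hmem (hsub hr)).1 (hb r hr).2
      (h.flow_mem hmem' (hsub hr)).2.le (hpos r hr) (by linarith [hΦa r hr, (hb r hr).1])
    have h2 : (2 - 1 / κ) / 8 = 2 * c := by rw [hc]; ring
    rwa [h2] at this
  · simp only [h.flow_init a haI, (hinit a haI).1, hψa]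
  · simpa only [h.flow_init a haI] using hbig

end Plateau

/-- A smooth plateau, rising on `[a/2, a]` and falling on `[1/2, 3/4]`. -/
noncomputable def plateau (a x : ℝ) : ℝ :=
  Real.smoothTransition (2 * x / a - 1) * Real.smoothTransition (3 - 4 * x)

theorem plateau_eq_one {a x : ℝ} (ha : 0 < a) (hax : a ≤ x) (hx : x ≤ 1 / 2) :
    plateau a x = 1 := by
  rw [plateau, Real.smoothTransition.one_of_one_le, Real.smoothTransition.one_of_one_le, one_mul]
  · linarith
  · have : 2 ≤ 2 * x / a := by rw [le_div_iff₀ ha]; linarith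
    linarith

theorem plateau_eq_zero {a x : ℝ} (ha : 0 < a) (hx : x ∉ Set.Icc (a / 2) (3 / 4)) :
    plateau a x = 0 := by
  rw [Set.mem_Icc, not_and_or, not_le, not_le] at hx
  rcases hx with hx | hx
  · rw [plateau, Real.smoothTransition.zero_of_nonpos, zero_mul]
    have : 2 * x / a ≤ 1 := by rw [div_le_one ha]; linarith
    linarith
  · rw [plateau, Real.smoothTransition.zero_of_nonpos (x := 3 - 4 * x), mul_zero]
    linarith

theorem contDiff_plateau (a : ℝ) : ContDiff ℝ (⊤ : ℕ∞) (plateau a) := by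
  unfold plateau
  exact (Real.smoothTransition.contDiff.comp (by fun_prop)).mul
    (Real.smoothTransition.contDiff.comp (by fun_prop))

theorem isPlateau_plateau {a : ℝ} (ha : 0 < a) (ha1 : a ≤ 1 / 128) :
    IsPlateau (a / 2) (plateau a) where
  nonneg x := mul_nonneg (Real.smoothTransition.nonneg _) (Real.smoothTransition.nonneg _)
  le_one x := mul_le_one₀ (Real.smoothTransition.le_one _) (Real.smoothTransition.nonneg _)
    (Real.smoothTransition.le_one _)
  mono x hx y hy hxy := by
    rw [plateau, plateau, Real.smoothTransition.one_of_one_le (x := 3 - 4 * x) (by linarith [hx.2]),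
      Real.smoothTransition.one_of_one_le (x := 3 - 4 * y) (by linarith [hy.2]), mul_one, mul_one]
    refine Real.smoothTransition.monotone ?_
    gcongr
  eq_one x hx hx' := plateau_eq_one ha (ha1.trans hx) hx'
  eq_zero x _ hx := plateau_eq_zero ha fun hx' => hx'.1.not_gt hx

/-- **Finite time blow up for the non-sign-definite model.** If `β₂ ≤ 1 ≤ β₁ < 2β₂`,
there are nonnegative smooth initial data compactly supported in `(0,1)` and a finite time
`T* > 0` such that no classical solution with this data exists on all of `[0,T*]`, i.e.
every classical solution on `[0,T)` with this data has `T ≤ T*`. -/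
theorem finite_time_blowup (β₁ β₂ : ℝ) (hβ₂ : 0 < β₂) (hβ₂1 : β₂ ≤ 1) (hβ₁ : 1 ≤ β₁)
    (hβ : β₁ < 2 * β₂) :
    ∃ ω₀ ρ₀ : ℝ → ℝ, ∃ Tstar : ℝ, 0 < Tstar ∧
      ContDiffOn ℝ (⊤ : ℕ∞) ω₀ (Set.Ioo 0 1) ∧ ContDiffOn ℝ (⊤ : ℕ∞) ρ₀ (Set.Ioo 0 1) ∧
      (∀ x, 0 ≤ ω₀ x ∧ 0 ≤ ρ₀ x) ∧
      (∃ a b : ℝ, 0 < a ∧ a ≤ b ∧ b < 1 ∧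
        ∀ x, x ∉ Set.Icc a b → ω₀ x = 0 ∧ ρ₀ x = 0) ∧
      ∀ T : ℝ, ∀ ω ρ Φ : ℝ → ℝ → ℝ,
        IsClassicalSolution β₁ β₂ T ω ρ Φ →
        (∀ x ∈ Set.Ioo (0:ℝ) 1, ω x 0 = ω₀ x ∧ ρ x 0 = ρ₀ x) →
        T ≤ Tstar := by
  have hβ₁0 : 0 < β₁ := by linarith
  set κ := β₂ / β₁ with hκdef
  have hκ : 1 / 2 < κ := by rw [hκdef, lt_div_iff₀ hβ₁0]; linarith
  have hκ1 : κ ≤ 1 := by rw [hκdef, div_le_one hβ₁0]; linarith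
  have hβκ : β₂ = κ * β₁ := by rw [hκdef]; field_simp
  set s := (2 * κ - 1) / 1000 with hs
  set c := (2 - 1 / κ) / 16 with hc
  have hc0 : 0 < c := by
    have : 1 / κ < 2 := by rw [div_lt_iff₀ (by linarith)]; linarith
    rw [hc]; linarith
  set N := c * (1 + (2 / (c * s)) ^ 2) with hN
  have hN0 : 0 ≤ N := by positivity
  set a := 1 / (1024 + N) with ha
  have ha0 : 0 < a := by positivity
  have ha1 : a ≤ 1 / 1024 := by rw [ha]; gcongr; linarith
  have hψ := isPlateau_plateau ha0 (by linarith)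
  refine ⟨plateau a, plateau a, s, by rw [hs]; linarith, (contDiff_plateau a).contDiffOn,
    (contDiff_plateau a).contDiffOn, fun x => ⟨hψ.nonneg x, hψ.nonneg x⟩,
    ⟨a / 2, 3 / 4, by positivity, by linarith, by norm_num,
      fun x hx => ⟨plateau_eq_zero ha0 hx, plateau_eq_zero ha0 hx⟩⟩, ?_⟩
  intro T ω ρ Φ h hinit
  refine lifespan_le h hψ hinit ⟨by positivity, by linarith⟩ hβκ hκ hκ1 hβ₁ hβ₂1 (by linarith)
    ha0 ha1 (plateau_eq_one ha0 le_rfl (by linarith)) hc hs ?_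
  rw [ha, one_div_one_div]
  linarith
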